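/- arXiv:2303.06070 — 2 statements merged into one kernel-verified Lean document; each statement's English description precedes it below -/
import Mathlib

section
/- Let G be a finite graph and let G̅ be its complement. Then the precedence independent thinness of G equals the precedence complete thinness of G̅, i.e., indfp(G) = compfp(G̅); and the precedence independent proper thinness of G equals the precedence complete proper thinness of G̅, i.e., indfpp(G) = compfpp(G̅). -/
open Function

/-- An order (given by an injective `ord` into `ℕ`) is *consistent* with a partition
(given by a coloring `c`) of the vertices of `G` if for every triple `p < q < r` with
`p`, `q` in the same class and `p` adjacent to `r`, also `q` is adjacent to `r`. -/
def Consistent {V α : Type*} (G : SimpleGraph V) (c : V → α) (ord : V → ℕ) : Prop :=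
  ∀ p q r : V, ord p < ord q → ord q < ord r → c p = c q → G.Adj p r → G.Adj q r

/-- An order is *strongly consistent* with a partition if both it and its reverse are
consistent with the partition. -/
def StronglyConsistent {V α : Type*} (G : SimpleGraph V) (c : V → α) (ord : V → ℕ) : Prop :=
  Consistent G c ord ∧
    ∀ p q r : V, ord q < ord p → ord r < ord q → c p = c q → G.Adj p r → G.Adj q r

/-- A partition is a *precedence partition* w.r.t. an order if every class is a set of
consecutive vertices (an interval) in the order. -/
def PrecedencePartition {V α : Type*} (c : V → α) (ord : V → ℕ) : Prop :=
  ∀ p q r : V, ord p < ord q → ord q < ord r → c p = c r → c q = c p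

/-- Every class of the partition is an independent set. -/
def IndepClasses {V α : Type*} (G : SimpleGraph V) (c : V → α) : Prop :=
  ∀ u v : V, c u = c v → ¬ G.Adj u v

/-- Every class of the partition is a clique (complete set). -/
def CompleteClasses {V α : Type*} (G : SimpleGraph V) (c : V → α) : Prop :=
  ∀ u v : V, c u = c v → u ≠ v → G.Adj u v

noncomputable def indfp {V : Type*} (G : SimpleGraph V) : ℕ :=
  sInf {k | ∃ (c : V → Fin k) (ord : V → ℕ), Injective ord ∧ IndepClasses G c ∧ PrecedencePartition c ord ∧ Consistent G c ord}

noncomputable def indfpp {V : Type*} (G : SimpleGraph V) : ℕ :=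
  sInf {k | ∃ (c : V → Fin k) (ord : V → ℕ), Injective ord ∧ IndepClasses G c ∧ PrecedencePartition c ord ∧ StronglyConsistent G c ord}

noncomputable def compfp {V : Type*} (G : SimpleGraph V) : ℕ :=
  sInf {k | ∃ (c : V → Fin k) (ord : V → ℕ), Injective ord ∧ CompleteClasses G c ∧ PrecedencePartition c ord ∧ Consistent G c ord}

noncomputable def compfpp {V : Type*} (G : SimpleGraph V) : ℕ :=
  sInf {k | ∃ (c : V → Fin k) (ord : V → ℕ), Injective ord ∧ CompleteClasses G c ∧ PrecedencePartition c ord ∧ StronglyConsistent G c ord}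

/-- `ord'` is obtained from `ord` by reversing the order inside each class of `c`. -/
def ReversesClasses {V α : Type*} (c : V → α) (ord ord' : V → ℕ) : Prop :=
  ∀ p q : V, ord' p < ord' q ↔ (c p = c q ∧ ord q < ord p) ∨ (c p ≠ c q ∧ ord p < ord q)

theorem PrecedencePartition.lt_of_class_ne {V α : Type*} {c : V → α} {ord : V → ℕ}
    (hc : PrecedencePartition c ord) (ho : Injective ord) {p q a b : V} (hpq : c p ≠ c q)
    (hlt : ord p < ord q) (ha : c a = c p) (hb : c b = c q) : ord a < ord b := by
  by_contra! hba
  have hne : ord b ≠ ord a := fun h ↦ hpq (by rw [← ha, ← hb, ho h])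
  have hne' : ord b ≠ ord p := fun h ↦ hpq (by rw [← hb, ho h])
  rcases lt_or_gt_of_ne hne' with h | h
  · exact hpq ((hc b p q h hlt hb).trans hb)
  · exact hpq ((hc p b a h (lt_of_le_of_ne hba hne) ha.symm).symm.trans hb)

theorem PrecedencePartition.exists_reversesClasses {V α : Type*} [Finite V] {c : V → α}
    {ord : V → ℕ} (hc : PrecedencePartition c ord) (ho : Injective ord) :
    ∃ ord' : V → ℕ, ReversesClasses c ord ord' := by
  have hlo (v : V) : ∃ a, c a = c v ∧ ∀ u, c u = c v → ord a ≤ ord u :=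
    Set.exists_min_image {u | c u = c v} ord (Set.toFinite _) ⟨v, rfl⟩
  have hhi (v : V) : ∃ a, c a = c v ∧ ∀ u, c u = c v → ord u ≤ ord a :=
    Set.exists_max_image {u | c u = c v} ord (Set.toFinite _) ⟨v, rfl⟩
  choose lo lo_class lo_le using hlo
  choose hi hi_class le_hi using hhi
  have separated {p q : V} (hpq : c p ≠ c q) (hlt : ord p < ord q) :
      ord (lo p) + ord (hi p) - ord p < ord (lo q) + ord (hi q) - ord q := by
    have := hc.lt_of_class_ne ho hpq hlt (hi_class p) (lo_class q)
    have := lo_le p p rfl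
    have := le_hi q q rfl
    omega
  refine ⟨fun v ↦ ord (lo v) + ord (hi v) - ord v, fun p q ↦ ?_⟩
  by_cases hpq : c p = c q
  · have := (lo_le p (lo q) (by rw [lo_class, hpq])).antisymm
      (lo_le q (lo p) (by rw [lo_class, hpq]))
    have := (le_hi q (hi p) (by rw [hi_class, hpq])).antisymm
      (le_hi p (hi q) (by rw [hi_class, hpq]))
    have := le_hi p p rfl
    have := le_hi q q rfl
    simp only [hpq, true_and, ne_eq, not_true_eq_false, false_and, or_false]
    omega
  · simp only [hpq, false_and, false_or, ne_eq, not_false_eq_true, true_and]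
    refine ⟨fun h ↦ ?_, separated hpq⟩
    by_contra! hle
    have hne : ord q ≠ ord p := fun h ↦ hpq (by rw [ho h])
    exact absurd (separated (Ne.symm hpq) (lt_of_le_of_ne hle hne)) (by omega)

/-- Reversing a strict order inside the classes of a partition into independent sets, or into
cliques, turns consistency for `G` into consistency for `Gᶜ`. -/
theorem compl_adj_of_reverses {V α : Type*} {G : SimpleGraph V} {c : V → α}
    {lt lt' : V → V → Prop} (hi : IndepClasses G c ∨ CompleteClasses G c)
    (htrans : ∀ p q r, lt' p q → lt' q r → lt' p r) (hirrefl : ∀ p, ¬ lt' p p)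
    (h : ∀ p q, lt' p q ↔ (c p = c q ∧ lt q p) ∨ (c p ≠ c q ∧ lt p q))
    (hG : ∀ p q r, lt p q → lt q r → c p = c q → G.Adj p r → G.Adj q r)
    (p q r : V) (hpq : lt' p q) (hqr : lt' q r) (hc : c p = c q) (hpr : Gᶜ.Adj p r) :
    Gᶜ.Adj q r := by
  have hne : q ≠ r := fun e ↦ hirrefl r (e ▸ hqr)
  rw [SimpleGraph.compl_adj] at hpr ⊢
  refine ⟨hne, fun hadj ↦ ?_⟩
  by_cases hcr : c q = c r
  · rcases hi with hi | hi
    · exact hi q r hcr hadj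
    · exact hpr.2 (hi p r (hc.trans hcr) hpr.1)
  · have hqp : lt q p := by simpa [hc] using (h p q).1 hpq
    have hpr' : lt p r := by simpa [hc, hcr] using (h p r).1 (htrans p q r hpq hqr)
    exact hpr.2 (hG q p r hqp hpr' hc.symm hadj)

theorem completeClasses_compl_iff {V α : Type*} {G : SimpleGraph V} {c : V → α} :
    CompleteClasses Gᶜ c ↔ IndepClasses G c := by
  refine ⟨fun h u v huv hadj ↦ ?_, fun h u v huv hne ↦ ?_⟩
  · exact ((SimpleGraph.compl_adj G u v).1 (h u v huv hadj.ne)).2 hadj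
  · exact (SimpleGraph.compl_adj G u v).2 ⟨hne, h u v huv⟩

namespace ReversesClasses

variable {V α : Type*} {c : V → α} {ord ord' : V → ℕ}

theorem injective (h : ReversesClasses c ord ord') (ho : Injective ord) : Injective ord' := by
  intro p q hpq
  apply ho
  have h₁ := h p q
  have h₂ := h q p
  grind

theorem precedencePartition (h : ReversesClasses c ord ord') (hc : PrecedencePartition c ord) :
    PrecedencePartition c ord' := by
  intro p q r hpq hqr hpr
  rw [h] at hpq hqr
  have := hc p q r
  grind

theorem consistent_compl {G : SimpleGraph V} (h : ReversesClasses c ord ord')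
    (hi : IndepClasses G c ∨ CompleteClasses G c) (hG : Consistent G c ord) :
    Consistent Gᶜ c ord' :=
  compl_adj_of_reverses hi (fun _ _ _ ↦ lt_trans) (fun _ ↦ lt_irrefl _) h hG

theorem stronglyConsistent_compl {G : SimpleGraph V} (h : ReversesClasses c ord ord')
    (hi : IndepClasses G c ∨ CompleteClasses G c) (hG : StronglyConsistent G c ord) :
    StronglyConsistent Gᶜ c ord' :=
  ⟨h.consistent_compl hi hG.1,
    compl_adj_of_reverses (lt := fun p q ↦ ord q < ord p) (lt' := fun p q ↦ ord' q < ord' p) hi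
      (fun _ _ _ h₁ h₂ ↦ h₂.trans h₁) (fun _ ↦ lt_irrefl _)
      (fun p q ↦ by rw [h q p, eq_comm, ne_comm]) hG.2⟩

end ReversesClasses

/-- Precedence independent thinness of a graph equals the precedence complete thinness
of its complement, and similarly for the proper versions. -/
theorem indfp_eq_compfp_compl {V : Type*} [Fintype V] (G : SimpleGraph V) :
    indfp G = compfp Gᶜ ∧ indfpp G = compfpp Gᶜ := by
  constructor
  · refine congrArg sInf (Set.ext fun k ↦ ⟨?_, ?_⟩)
    · rintro ⟨c, ord, ho, hi, hp, hc⟩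
      obtain ⟨ord', h⟩ := hp.exists_reversesClasses ho
      exact ⟨c, ord', h.injective ho, completeClasses_compl_iff.2 hi, h.precedencePartition hp,
        h.consistent_compl (.inl hi) hc⟩
    · rintro ⟨c, ord, ho, hi, hp, hc⟩
      obtain ⟨ord', h⟩ := hp.exists_reversesClasses ho
      exact ⟨c, ord', h.injective ho, completeClasses_compl_iff.1 hi, h.precedencePartition hp,
        compl_compl G ▸ h.consistent_compl (.inr hi) hc⟩
  · refine congrArg sInf (Set.ext fun k ↦ ⟨?_, ?_⟩)
    · rintro ⟨c, ord, ho, hi, hp, hc⟩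
      obtain ⟨ord', h⟩ := hp.exists_reversesClasses ho
      exact ⟨c, ord', h.injective ho, completeClasses_compl_iff.2 hi, h.precedencePartition hp,
        h.stronglyConsistent_compl (.inl hi) hc⟩
    · rintro ⟨c, ord, ho, hi, hp, hc⟩
      obtain ⟨ord', h⟩ := hp.exists_reversesClasses ho
      exact ⟨c, ord', h.injective ho, completeClasses_compl_iff.1 hi, h.precedencePartition hp,
        compl_compl G ▸ h.stronglyConsistent_compl (.inr hi) hc⟩
end

section
/- Let G be a finite graph whose vertex set is partitioned into two sets V¹ and V², and let < be a linear order on V(G) that is strongly consistent with the partition {V¹, V²} and such that every vertex of V¹ is smaller than every vertex of V² under <. Define a new linear order ≺ on V(G) by: all vertices of V¹ come first, ordered by the reverse of <, followed by the vertices of V², ordered by <. Then ≺ is a perfect order of G; in particular, every precedence proper 2-thin graph is perfectly orderable. -/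
open Function

/-- Consistency of an order (given by a function into a linear order) with a partition
(given by a coloring `c`). -/
def ConsistentWith {V α β : Type*} [LinearOrder β] (G : SimpleGraph V) (c : V → α)
    (ord : V → β) : Prop :=
  ∀ p q r : V, ord p < ord q → ord q < ord r → c p = c q → G.Adj p r → G.Adj q r

/-- Strong consistency: both the order and its reverse are consistent. -/
def StronglyConsistentWith {V α β : Type*} [LinearOrder β] (G : SimpleGraph V) (c : V → α)
    (ord : V → β) : Prop :=
  ConsistentWith G c ord ∧
    ∀ p q r : V, ord q < ord p → ord r < ord q → c p = c q → G.Adj p r → G.Adj q r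

/-- An order is a *perfect order* of `G` if `G` contains no induced path on four
vertices `a b c d` (edges `ab`, `bc`, `cd`; non-edges `ac`, `ad`, `bd`) with
`a ≺ b` and `d ≺ c`. -/
def PerfectOrder {V β : Type*} [LinearOrder β] (G : SimpleGraph V) (ord : V → β) : Prop :=
  ¬ ∃ a b c d : V, a ≠ b ∧ a ≠ c ∧ a ≠ d ∧ b ≠ c ∧ b ≠ d ∧ c ≠ d ∧
    G.Adj a b ∧ G.Adj b c ∧ G.Adj c d ∧
    ¬ G.Adj a c ∧ ¬ G.Adj a d ∧ ¬ G.Adj b d ∧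
    ord a < ord b ∧ ord d < ord c

/-- Given a partition of `V(G)` into `V¹`, `V²`, strongly consistent with an order `<`
such that every vertex of `V¹` precedes every vertex of `V²`, the order obtained by
taking `V¹` in reverse order followed by `V²` in order (realized below by the function
`v ↦ if v ∈ V¹ then -ord v else ord v` into `ℤ`) is a perfect order of `G`. In
particular, precedence proper 2-thin graphs are perfectly orderable. -/
theorem precedence_proper_two_thin_perfect_order {V : Type*} [Fintype V]
    (G : SimpleGraph V) (V1 V2 : Set V) [DecidablePred (· ∈ V1)]
    (hdisj : Disjoint V1 V2) (hcover : V1 ∪ V2 = Set.univ)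
    (ord : V → ℕ) (hinj : Injective ord)
    (hcons : StronglyConsistentWith G (fun v => v ∈ V1) ord)
    (hprec : ∀ u ∈ V1, ∀ w ∈ V2, ord u < ord w) :
    PerfectOrder G (fun v => if v ∈ V1 then -(ord v : ℤ) else (ord v : ℤ)) := by
  obtain ⟨hc, hc'⟩ := hcons
  have key : ∀ {p q r : V}, (p ∈ V1 ↔ q ∈ V1) → G.Adj p r →
      (ord p < ord q ∧ ord q < ord r) ∨ (ord q < ord p ∧ ord r < ord q) → G.Adj q r := by
    rintro p q r hpq hpr (⟨h₁, h₂⟩ | ⟨h₁, h₂⟩)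
    · exact hc p q r h₁ h₂ (propext hpq) hpr
    · exact hc' p q r h₁ h₂ (propext hpq) hpr
  have hlt : ∀ u v : V, u ∈ V1 → v ∉ V1 → ord u < ord v := fun u v hu hv =>
    hprec u hu v ((hcover ▸ Set.mem_univ v : v ∈ V1 ∪ V2).resolve_left hv)
  rintro ⟨a, b, c, d, -, hac, -, hbc, hbd, -, eab, ebc, ecd, nac, nad, nbd, h₁, h₂⟩
  have oac := hinj.ne hac
  have obc := hinj.ne hbc
  have obd := hinj.ne hbd
  have k₁ := fun h => mt (key (p := b) (q := a) (r := c) h ebc) nac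
  have k₂ := fun h => mt (key (p := b) (q := c) (r := a) h eab.symm) (mt SimpleGraph.Adj.symm nac)
  have k₃ := fun h => mt (key (p := c) (q := b) (r := d) h ecd) nbd
  have k₄ := fun h => mt (key (p := c) (q := d) (r := b) h ebc.symm) (mt SimpleGraph.Adj.symm nbd)
  have lab := hlt a b
  have lac := hlt a c
  have lbc := hlt b c
  have lca := hlt c a
  have lcb := hlt c b
  have ldb := hlt d b
  have ldc := hlt d c
  have lbd := hlt b d
  by_cases ha : a ∈ V1 <;> by_cases hb : b ∈ V1 <;> by_cases hc : c ∈ V1 <;>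
    by_cases hd : d ∈ V1 <;>
    simp only [ha, hb, hc, hd, if_true, if_false, not_true_eq_false, not_false_eq_true,
      forall_const, iff_self, iff_true, iff_false, false_implies, implies_true] at * <;> omega
end
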